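/- arXiv:1901.10310 — 2 statements merged into one kernel-verified Lean document; each statement's English description precedes it below -/
import Mathlib

section
/- With probability at least 1 − δ over the draw of the samples S_1, …, S_N, the minimizer ĥ_α of the α-weighted empirical risk satisfies ε_T(ĥ_α) ≤ ε_T(h_T*) + 4 Σ_{i=1}^N α_i R_i(H) + 2 Σ_{i=1}^N α_i d_H(D_i, D_T) + 6 √(log(4/δ) M² / 2) · √(Σ_{i=1}^N α_i² / m_i), where h_T* is a minimizer over H of the target expected risk ε_T and ĥ_α is a minimizer over H of the α-weighted empirical risk ε̂_α. (Theorem 1 of the paper.) -/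
open MeasureTheory

noncomputable section

/-- A Rademacher sign encoded by a Boolean. -/
def radSign (b : Bool) : ℝ := if b then 1 else -1

variable {X Y : Type*} [MeasurableSpace X] [MeasurableSpace Y]

/-- Expected risk of a predictor `f` under a distribution `P` on `X × Y`. -/
def expRisk (L : Y → Y → ℝ) (P : Measure (X × Y)) (f : X → Y) : ℝ :=
  ∫ z, L (f z.1) z.2 ∂P

/-- The α-weighted empirical risk of `f` on the samples `S`. -/
def empRisk {N : ℕ} (L : Y → Y → ℝ) (m : Fin N → ℕ) (α : Fin N → ℝ)
    (S : (i : Fin N) → Fin (m i) → X × Y) (f : X → Y) : ℝ :=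
  ∑ i, (α i / (m i : ℝ)) * ∑ j, L (f (S i j).1) (S i j).2

/-- Joint distribution of the samples: for each source `i`, `m i` i.i.d. draws from `D i`,
all sources mutually independent. -/
def sampleMeasure {N : ℕ} (m : Fin N → ℕ) (D : Fin N → Measure (X × Y)) :
    Measure ((i : Fin N) → Fin (m i) → X × Y) :=
  Measure.pi fun i => Measure.pi fun _ => D i

/-- Joint distribution of the i.i.d. Rademacher signs (encoded as Booleans). -/
def radMeasure (N : ℕ) (m : Fin N → ℕ) : Measure ((i : Fin N) → Fin (m i) → Bool) :=
  Measure.pi fun _ => Measure.pi fun _ => (PMF.uniformOfFintype Bool).toMeasure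

/-- Data-dependent Rademacher complexity of source `i`. -/
def radComplexity {ι : Type*} {N : ℕ} (L : Y → Y → ℝ) (h : ι → X → Y) (m : Fin N → ℕ)
    (S : (i : Fin N) → Fin (m i) → X × Y) (i : Fin N) : ℝ :=
  ∫ σ, (⨆ k, (1 / (m i : ℝ)) * ∑ j, radSign (σ i j) * L (h k (S i j).1) (S i j).2)
    ∂(radMeasure N m)

/-- Discrepancy between two distributions with respect to the hypothesis class `h`. -/
def discrepancy {ι : Type*} (L : Y → Y → ℝ) (h : ι → X → Y) (P Q : Measure (X × Y)) : ℝ :=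
  ⨆ k, |expRisk L P (h k) - expRisk L Q (h k)|

lemma aux_intb {Ω : Type*} [MeasurableSpace Ω] (μ : Measure Ω) [IsProbabilityMeasure μ]
    {f : Ω → ℝ} (hf : Measurable f) (C : ℝ) (hC : ∀ x, |f x| ≤ C) : Integrable f μ :=
  Integrable.of_bound hf.aestronglyMeasurable C (Filter.Eventually.of_forall hC)

lemma aux_expint {Ω : Type*} [MeasurableSpace Ω] (μ : Measure Ω) [IsProbabilityMeasure μ]
    {f : Ω → ℝ} (hf : Measurable f) (C : ℝ) (hC : ∀ x, |f x| ≤ C) :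
    Integrable (fun x => Real.exp (f x)) μ := by
  refine aux_intb μ (Real.measurable_exp.comp hf) (Real.exp C) fun x => ?_
  rw [abs_of_pos (Real.exp_pos _)]
  exact Real.exp_le_exp.2 ((abs_le.1 (hC x)).2)

lemma aux_intabs {Ω : Type*} [MeasurableSpace Ω] (μ : Measure Ω) [IsProbabilityMeasure μ]
    {f : Ω → ℝ} (C : ℝ) (hC : ∀ x, |f x| ≤ C) : |∫ x, f x ∂μ| ≤ C := by
  have := norm_integral_le_of_norm_le_const (μ := μ) (f := f) (C := C)
    (Filter.Eventually.of_forall hC)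
  simpa using this

lemma aux_hoeff {Ω : Type*} [MeasurableSpace Ω] (μ : Measure Ω) [IsProbabilityMeasure μ]
    {f : Ω → ℝ} (hf : Measurable f) (c : ℝ)
    (hc : ∀ x y, |f x - f y| ≤ c) (s : ℝ) :
    ∫ x, Real.exp (s * (f x - ∫ y, f y ∂μ)) ∂μ ≤ Real.exp (s ^ 2 * c ^ 2 / 8) := by
  obtain ⟨x0⟩ := nonempty_of_isProbabilityMeasure μ
  have hc0 : 0 ≤ c := (abs_nonneg _).trans (hc x0 x0)
  have hbdd : BddAbove (Set.range f) :=
    ⟨f x0 + c, by rintro _ ⟨x, rfl⟩; have := (abs_le.1 (hc x x0)).2; linarith⟩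
  have key := ProbabilityTheory.hasSubgaussianMGF_of_mem_Icc (μ := μ) (X := f)
    (a := (⨆ x, f x) - c) (b := ⨆ x, f x) hf.aemeasurable
    (Filter.Eventually.of_forall fun x => by
      refine ⟨?_, le_ciSup hbdd x⟩
      have : Nonempty Ω := ⟨x0⟩
      have : ⨆ x, f x ≤ f x + c := ciSup_le fun y => by
        have := (abs_le.1 (hc y x)).2; linarith
      linarith)
  have := key.mgf_le s
  unfold ProbabilityTheory.mgf at this
  refine this.trans (Real.exp_le_exp.2 (le_of_eq ?_))
  push_cast
  rw [sub_sub_cancel, Real.norm_of_nonneg hc0]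
  ring

lemma aux_mcd {Ω : Type*} [MeasurableSpace Ω] (μ : Measure Ω) [IsProbabilityMeasure μ]
    (c C s : ℝ) : ∀ (n : ℕ) (f : (Fin n → Ω) → ℝ), Measurable f → (∀ x, |f x| ≤ C) →
    (∀ x i y, |f x - f (Function.update x i y)| ≤ c) →
    ∫ x, Real.exp (s * (f x - ∫ y, f y ∂(Measure.pi fun _ => μ))) ∂(Measure.pi fun _ => μ)
      ≤ Real.exp (n * (s ^ 2 * c ^ 2 / 8)) := by
  intro n
  induction n with
  | zero =>
    intro f hf hC hc
    have : ∀ x, f x = f default := fun x => congrArg f (Subsingleton.elim _ _)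
    simp_rw [this]
    simp
  | succ n ih =>
    intro f hf hC hc
    have mp := (measurePreserving_piFinSuccAbove (fun _ : Fin (n+1) => μ) 0).symm
    have hF : ∀ p : Ω × (Fin n → Ω),
        (MeasurableEquiv.piFinSuccAbove (fun _ : Fin (n+1) => Ω) 0).symm p
          = (Fin.cons p.1 p.2 : Fin (n+1) → Ω) := by
      intro p
      exact Fin.insertNth_zero' _ _
    set P := Measure.pi fun _ : Fin n => μ with hP
    set F : Ω × (Fin n → Ω) → ℝ := fun p => f (Fin.cons p.1 p.2) with hFdef
    have hFm : Measurable F := by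
      have : F = f ∘ (MeasurableEquiv.piFinSuccAbove (fun _ : Fin (n+1) => Ω) 0).symm := by
        ext p; simp only [hFdef, Function.comp, hF]
      rw [this]; exact hf.comp (MeasurableEquiv.measurable _)
    have hFC : ∀ p, |F p| ≤ C := fun p => hC _
    have tr : ∀ φ : ℝ → ℝ, ∫ x, φ (f x) ∂(Measure.pi fun _ : Fin (n+1) => μ)
        = ∫ p, φ (F p) ∂(μ.prod P) := by
      intro φ
      have := mp.integral_comp' (fun x => φ (f x))
      rw [← this]
      refine integral_congr_ae (Filter.Eventually.of_forall fun p => ?_)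
      simp only [hF, hFdef]
    have e1 : ∫ x, f x ∂(Measure.pi fun _ : Fin (n+1) => μ) = ∫ p, F p ∂(μ.prod P) := tr id
    set E := ∫ p, F p ∂(μ.prod P) with hE
    rw [e1, tr (fun t => Real.exp (s * (t - E)))]
    set g : (Fin n → Ω) → ℝ := fun y => ∫ x, F (x, y) ∂μ with hg
    have hgm : Measurable g := by
      have := StronglyMeasurable.integral_prod_left (μ := μ) (f := fun x y => F (x, y))
        hFm.stronglyMeasurable
      exact this.measurable
    have hgC : ∀ y, |g y| ≤ C := fun y => aux_intabs μ C fun x => hFC _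
    have hsec : ∀ y, Measurable fun x => F (x, y) := fun y => hFm.comp (by fun_prop)
    have hseci : ∀ y, Integrable (fun x => F (x, y)) μ := fun y => aux_intb μ (hsec y) C fun x => hFC _
    have hEg : E = ∫ y, g y ∂P := integral_prod_symm F (aux_intb _ hFm C hFC)
    have hgc : ∀ x i y, |g x - g (Function.update x i y)| ≤ c := by
      intro x i y
      rw [hg]
      simp only
      rw [← integral_sub (hseci _) (hseci _)]
      refine aux_intabs μ c fun a => ?_
      have := hc (Fin.cons a x) i.succ y
      rw [← Fin.cons_update] at this
      exact this
    have IH := ih g hgm hgC hgc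
    rw [← hEg] at IH
    have hbd : ∀ p, |s * (F p - E)| ≤ |s| * (C + |E|) := fun p => by
      rw [abs_mul]
      exact mul_le_mul_of_nonneg_left ((abs_sub _ _).trans (by linarith [hFC p])) (abs_nonneg _)
    have hbd2 : ∀ y, |s * (g y - E)| ≤ |s| * (C + |E|) := fun p => by
      rw [abs_mul]
      exact mul_le_mul_of_nonneg_left ((abs_sub _ _).trans (by linarith [hgC p])) (abs_nonneg _)
    have hI := aux_expint (μ.prod P) (f := fun p => s * (F p - E)) (by fun_prop) _ hbd
    rw [integral_prod_symm _ hI]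
    have step : ∀ y, ∫ x, Real.exp (s * (F (x, y) - E)) ∂μ
        ≤ Real.exp (s ^ 2 * c ^ 2 / 8) * Real.exp (s * (g y - E)) := by
      intro y
      have hh := aux_hoeff μ (hsec y) c (fun a b => by
        have := hc (Fin.cons a y) 0 b
        rw [Fin.update_cons_zero] at this
        exact this) s
      have : ∀ x, Real.exp (s * (F (x, y) - E))
          = Real.exp (s * (F (x, y) - g y)) * Real.exp (s * (g y - E)) := fun x => by
        rw [← Real.exp_add]; ring_nf
      simp_rw [this]
      rw [integral_mul_const]
      exact mul_le_mul_of_nonneg_right hh (Real.exp_pos _).le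
    calc _ ≤ ∫ y, Real.exp (s ^ 2 * c ^ 2 / 8) * Real.exp (s * (g y - E)) ∂P := by
            refine integral_mono hI.integral_prod_right ?_ step
            exact (aux_expint P (f := fun y => s * (g y - E)) (by fun_prop) _ hbd2).const_mul _
      _ = Real.exp (s ^ 2 * c ^ 2 / 8) * ∫ y, Real.exp (s * (g y - E)) ∂P := integral_const_mul _ _
      _ ≤ Real.exp (s ^ 2 * c ^ 2 / 8) * Real.exp (n * (s ^ 2 * c ^ 2 / 8)) :=
            mul_le_mul_of_nonneg_left IH (Real.exp_pos _).le
      _ = _ := by rw [← Real.exp_add]; push_cast; ring_nf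

lemma aux_avg {n : ℕ} (a : Fin n → ℝ) (C : ℝ) (hC0 : 0 ≤ C) (hC : ∀ j, |a j| ≤ C) :
    |(1 / (n : ℝ)) * ∑ j, a j| ≤ C := by
  rcases Nat.eq_zero_or_pos n with rfl | hn
  · simpa using hC0
  have hn' : (0 : ℝ) < n := by exact_mod_cast hn
  rw [abs_mul, abs_of_nonneg (by positivity)]
  have : |∑ j, a j| ≤ n * C := by
    refine (Finset.abs_sum_le_sum_abs _ _).trans ((Finset.sum_le_sum fun j _ => hC j).trans ?_)
    simp
  calc 1 / (n : ℝ) * |∑ j, a j| ≤ 1 / (n : ℝ) * (n * C) := by gcongr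
    _ = C := by field_simp

lemma aux_bdd {ι : Type*} (a : ι → ℝ) (C : ℝ) (hC : ∀ k, |a k| ≤ C) :
    BddAbove (Set.range a) := ⟨C, by rintro _ ⟨k, rfl⟩; exact (abs_le.1 (hC k)).2⟩

lemma aux_supabs {ι : Type*} [Nonempty ι] (a : ι → ℝ) (C : ℝ) (hC : ∀ k, |a k| ≤ C) :
    |⨆ k, a k| ≤ C := by
  refine abs_le.2 ⟨?_, ciSup_le fun k => (abs_le.1 (hC k)).2⟩
  obtain ⟨k⟩ := ‹Nonempty ι›
  exact (abs_le.1 (hC k)).1.trans (le_ciSup (aux_bdd a C hC) k)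

lemma aux_supdiff {ι : Type*} [Nonempty ι] (a b : ι → ℝ) (C c : ℝ) (ha : ∀ k, |a k| ≤ C)
    (hb : ∀ k, |b k| ≤ C) (hc : ∀ k, |a k - b k| ≤ c) :
    |(⨆ k, a k) - ⨆ k, b k| ≤ c := by
  have h1 : ⨆ k, a k ≤ (⨆ k, b k) + c := ciSup_le fun k => by
    have := le_ciSup (aux_bdd b C hb) k
    have := (abs_le.1 (hc k)).2
    linarith
  have h2 : ⨆ k, b k ≤ (⨆ k, a k) + c := ciSup_le fun k => by
    have := le_ciSup (aux_bdd a C ha) k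
    have := (abs_le.1 (hc k)).1
    linarith
  exact abs_le.2 ⟨by linarith, by linarith⟩

lemma aux_upd {Z : Type*} {n : ℕ} (φ : Fin n → Z → ℝ) (M : ℝ)
    (hφ : ∀ j a b, |φ j a - φ j b| ≤ M) (z : Fin n → Z) (i : Fin n) (y : Z) :
    |(1 / (n : ℝ)) * ∑ j, φ j (z j) - (1 / (n : ℝ)) * ∑ j, φ j (Function.update z i y j)|
      ≤ M / n := by
  rw [← mul_sub, ← Finset.sum_sub_distrib, Finset.sum_eq_single i]
  · rw [abs_mul, abs_of_nonneg (by positivity)]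
    calc _ ≤ 1 / (n : ℝ) * M := by gcongr; exact hφ _ _ _
      _ = _ := by ring
  · intro j _ hj
    simp [Function.update_of_ne hj]
  · simp

lemma aux_radSign (b : Bool) : |radSign b| = 1 := by cases b <;> simp [radSign]

lemma aux_radSign_not (b : Bool) : radSign (!b) = - radSign b := by cases b <;> simp [radSign]

lemma aux_radSign_meas : Measurable radSign := measurable_of_countable _

def radB (n : ℕ) : Measure (Fin n → Bool) :=
  Measure.pi fun _ => (PMF.uniformOfFintype Bool).toMeasure

instance aux_radB_prob (n : ℕ) : IsProbabilityMeasure (radB n) := by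
  unfold radB; infer_instance

lemma aux_not (n : ℕ) : MeasurePreserving (fun (σ : Fin n → Bool) j => !(σ j)) (radB n) (radB n) := by
  unfold radB
  refine measurePreserving_pi _ _ (f := fun _ b => !b) fun _ => ⟨measurable_of_countable _, ?_⟩
  rw [PMF.toMeasure_map _ _ (measurable_of_countable _)]
  congr 1
  ext b
  cases b <;> simp [PMF.map_apply]

lemma aux_not_int (n : ℕ) (J : (Fin n → Bool) → ℝ) :
    ∫ σ, J (fun j => !(σ j)) ∂(radB n) = ∫ σ, J σ ∂(radB n) := by
  have := integral_map (μ := radB n) (aux_not n).measurable.aemeasurable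
    (f := J) (measurable_of_countable J).aestronglyMeasurable
  rw [(aux_not n).map_eq] at this
  exact this.symm

section sym
variable {ι Z : Type*} [Countable ι] [Nonempty ι] [MeasurableSpace Z]

def rSup (g : ι → Z → ℝ) {n : ℕ} (σ : Fin n → Bool) (z : Fin n → Z) : ℝ :=
  ⨆ k, (1 / (n : ℝ)) * ∑ j, radSign (σ j) * g k (z j)

def rad (g : ι → Z → ℝ) {n : ℕ} (z : Fin n → Z) : ℝ := ∫ σ, rSup g σ z ∂(radB n)

def dev (g : ι → Z → ℝ) (μ : Measure Z) {n : ℕ} (z : Fin n → Z) : ℝ :=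
  ⨆ k, (∫ x, g k x ∂μ - (1 / (n : ℝ)) * ∑ j, g k (z j))

variable (g : ι → Z → ℝ) (hg : ∀ k, Measurable (g k)) (M : ℝ) (hM : 0 < M)
  (hg0 : ∀ k z, 0 ≤ g k z) (hgM : ∀ k z, g k z ≤ M)
  (μ : Measure Z) [IsProbabilityMeasure μ] {n : ℕ}

include hM hg0 hgM

omit [Countable ι] [MeasurableSpace Z] [Nonempty ι] hM in
lemma aux_gabs (k : ι) (z : Z) : |g k z| ≤ M := abs_le.2 ⟨by linarith [hg0 k z, hgM k z], hgM k z⟩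

omit [Countable ι] [Nonempty ι] [MeasurableSpace Z] in
lemma aux_rin (σ : Fin n → Bool) (z : Fin n → Z) (k : ι) :
    |(1 / (n : ℝ)) * ∑ j, radSign (σ j) * g k (z j)| ≤ M :=
  aux_avg _ M hM.le fun j => by
    rw [abs_mul, aux_radSign, one_mul]; exact aux_gabs g M hg0 hgM k _

omit [Countable ι] [MeasurableSpace Z] in
lemma aux_rabs (σ : Fin n → Bool) (z : Fin n → Z) : |rSup g σ z| ≤ M :=
  aux_supabs _ M (aux_rin g M hM hg0 hgM σ z)

omit [Countable ι] [MeasurableSpace Z] in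
lemma aux_rint (z : Fin n → Z) : Integrable (fun σ => rSup g σ z) (radB n) :=
  aux_intb _ (measurable_of_countable _) M fun σ => aux_rabs g M hM hg0 hgM σ z

omit [Countable ι] [MeasurableSpace Z] in
lemma aux_radabs (z : Fin n → Z) : |rad g z| ≤ M :=
  aux_intabs _ M fun σ => aux_rabs g M hM hg0 hgM σ z

omit [Countable ι] [MeasurableSpace Z] in
lemma aux_rad_nonneg (z : Fin n → Z) : 0 ≤ rad g z := by
  have h1 : 2 * rad g z = ∫ σ, (rSup g σ z + rSup g (fun j => !(σ j)) z) ∂(radB n) := by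
    rw [integral_add (aux_rint g M hM hg0 hgM z)
      (aux_intb _ (measurable_of_countable _) M fun σ => aux_rabs g M hM hg0 hgM _ z),
      aux_not_int n (fun σ => rSup g σ z)]
    unfold rad; ring
  have h2 : 0 ≤ ∫ σ, (rSup g σ z + rSup g (fun j => !(σ j)) z) ∂(radB n) := by
    refine integral_nonneg fun σ => ?_
    obtain ⟨k⟩ := ‹Nonempty ι›
    have a1 := le_ciSup (aux_bdd _ M (aux_rin g M hM hg0 hgM σ z)) k
    have a2 := le_ciSup (aux_bdd _ M (aux_rin g M hM hg0 hgM (fun j => !(σ j)) z)) k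
    simp only [aux_radSign_not, neg_mul, Finset.sum_neg_distrib, mul_neg] at a2
    have e : rSup g (fun j => !(σ j)) z
      = ⨆ k, -((1 / (n : ℝ)) * ∑ j, radSign (σ j) * g k (z j)) := by
      unfold rSup
      simp only [aux_radSign_not, neg_mul, Finset.sum_neg_distrib, mul_neg]
    have e' : rSup g σ z = ⨆ k, ((1 / (n : ℝ)) * ∑ j, radSign (σ j) * g k (z j)) := rfl
    show 0 ≤ rSup g σ z + rSup g (fun j => !(σ j)) z
    rw [e, e']
    linarith
  linarith

omit hM hg0 hgM in
include hg in
omit [Nonempty ι] in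
lemma aux_rmeas (σ : Fin n → Bool) : Measurable (rSup g (n := n) σ) := by
  unfold rSup
  refine Measurable.iSup fun k => ?_
  have := hg k
  fun_prop

omit hM hg0 hgM in
include hg in
omit [Nonempty ι] in
lemma aux_rmeas2 : Measurable (fun p : (Fin n → Bool) × (Fin n → Z) => rSup g p.1 p.2) :=
  measurable_from_prod_countable_right fun σ => aux_rmeas g hg σ

omit hM hg0 hgM in
include hg in
omit [Nonempty ι] in
lemma aux_radmeas : Measurable (rad g (n := n)) := by
  have := StronglyMeasurable.integral_prod_left (μ := radB n)
    (f := fun (σ : Fin n → Bool) (z : Fin n → Z) => rSup g σ z)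
    (aux_rmeas2 g hg).stronglyMeasurable
  exact this.measurable

omit hM hg0 hgM in
include hg in
omit [Nonempty ι] [IsProbabilityMeasure μ] in
lemma aux_devmeas : Measurable (dev g μ (n := n)) := by
  unfold dev
  refine Measurable.iSup fun k => ?_
  have := hg k
  fun_prop

omit [Countable ι] [Nonempty ι] in
lemma aux_devin (z : Fin n → Z) (k : ι) :
    |∫ x, g k x ∂μ - (1 / (n : ℝ)) * ∑ j, g k (z j)| ≤ M := by
  have h1 := (abs_le.1 (aux_intabs μ M (aux_gabs g M hg0 hgM k))).2
  have h2 := (abs_le.1 (aux_avg (fun j => g k (z j)) M hM.le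
    fun j => aux_gabs g M hg0 hgM k _)).2
  have h3 : 0 ≤ ∫ x, g k x ∂μ := integral_nonneg (hg0 k)
  have h4 : 0 ≤ (1 / (n : ℝ)) * ∑ j, g k (z j) :=
    mul_nonneg (by positivity) (Finset.sum_nonneg fun j _ => hg0 k _)
  exact abs_le.2 ⟨by linarith, by linarith⟩

omit [Countable ι] in
lemma aux_devabs (z : Fin n → Z) : |dev g μ z| ≤ M := aux_supabs _ M (aux_devin g M hM hg0 hgM μ z)

omit [Countable ι] [MeasurableSpace Z] [Nonempty ι] hM in
lemma aux_gdiff (k : ι) (a b : Z) : |g k a - g k b| ≤ M :=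
  abs_le.2 ⟨by linarith [hg0 k a, hgM k b], by linarith [hg0 k b, hgM k a]⟩

omit [Countable ι] in
lemma aux_devdiff (z : Fin n → Z) (i : Fin n) (y : Z) :
    |dev g μ z - dev g μ (Function.update z i y)| ≤ M / n := by
  refine aux_supdiff _ _ M _ (aux_devin g M hM hg0 hgM μ z) (aux_devin g M hM hg0 hgM μ _) fun k => ?_
  rw [sub_sub_sub_cancel_left, abs_sub_comm]
  exact aux_upd (fun _ => g k) M (fun _ => aux_gdiff g M hg0 hgM k) z i y

omit [Countable ι] [MeasurableSpace Z] in
lemma aux_raddiff (z : Fin n → Z) (i : Fin n) (y : Z) :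
    |rad g z - rad g (Function.update z i y)| ≤ M / n := by
  unfold rad
  rw [← integral_sub (aux_rint g M hM hg0 hgM z) (aux_rint g M hM hg0 hgM _)]
  refine aux_intabs _ _ fun σ => ?_
  refine aux_supdiff _ _ M _ (aux_rin g M hM hg0 hgM σ z) (aux_rin g M hM hg0 hgM σ _) fun k => ?_
  refine aux_upd (fun j x => radSign (σ j) * g k x) M (fun j a b => ?_) z i y
  rw [← mul_sub, abs_mul, aux_radSign, one_mul]
  exact aux_gdiff g M hg0 hgM k a b

def symW (g : ι → Z → ℝ) {n : ℕ} (σ : Fin n → Bool) (p : (Fin n → Z) × (Fin n → Z)) : ℝ :=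
  ⨆ k, (1 / (n : ℝ)) * ∑ j, radSign (σ j) * (g k (p.2 j) - g k (p.1 j))

omit [Countable ι] [Nonempty ι] [MeasurableSpace Z] in
lemma aux_win (σ : Fin n → Bool) (p : (Fin n → Z) × (Fin n → Z)) (k : ι) :
    |(1 / (n : ℝ)) * ∑ j, radSign (σ j) * (g k (p.2 j) - g k (p.1 j))| ≤ M :=
  aux_avg _ M hM.le fun j => by
    rw [abs_mul, aux_radSign, one_mul]; exact aux_gdiff g M hg0 hgM k _ _

omit hM hg0 hgM in
include hg in
omit [Nonempty ι] in
lemma aux_wmeas (σ : Fin n → Bool) : Measurable (symW g (n := n) σ) := by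
  unfold symW
  refine Measurable.iSup fun k => ?_
  have := hg k
  fun_prop

include hg in
lemma aux_wint (σ : Fin n → Bool) (Q : Measure ((Fin n → Z) × (Fin n → Z)))
    [IsProbabilityMeasure Q] : Integrable (symW g σ) Q :=
  aux_intb _ (aux_wmeas g hg σ) M fun p => aux_supabs _ M (aux_win g M hM hg0 hgM σ p)

include hg in
lemma aux_stepA (hn : 1 ≤ n) :
    ∫ z, dev g μ z ∂(Measure.pi fun _ : Fin n => μ)
      ≤ ∫ p, symW g (fun _ => true) p
          ∂((Measure.pi fun _ : Fin n => μ).prod (Measure.pi fun _ : Fin n => μ)) := by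
  set P := Measure.pi fun _ : Fin n => μ with hP
  have hI := aux_wint g hg M hM hg0 hgM (fun _ : Fin n => true) (P.prod P)
  rw [integral_prod _ hI]
  refine integral_mono (aux_intb _ (aux_devmeas g hg μ) M (aux_devabs g M hM hg0 hgM μ))
    hI.integral_prod_left fun z => ?_
  refine ciSup_le fun k => ?_
  have hn' : (n : ℝ) ≠ 0 := by positivity
  have hgi : ∀ j : Fin n, Integrable (fun z' : Fin n → Z => g k (z' j)) P := fun j =>
    aux_intb _ ((hg k).comp (measurable_pi_apply j)) M fun z' => aux_gabs g M hg0 hgM k _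
  have hge : ∀ j : Fin n, ∫ z', g k (z' j) ∂P = ∫ x, g k x ∂μ := fun j => by
    have mp := measurePreserving_eval (fun _ : Fin n => μ) j
    have := integral_map (μ := P) mp.measurable.aemeasurable (f := g k)
      (hg k).aestronglyMeasurable
    rw [mp.map_eq] at this
    exact this.symm
  have e : ∫ x, g k x ∂μ - (1 / (n : ℝ)) * ∑ j, g k (z j)
      = ∫ z', (1 / (n : ℝ)) * ∑ j, radSign true * (g k (z' j) - g k (z j)) ∂P := by
    rw [integral_const_mul, integral_finsetSum]
    · simp only [radSign, if_true, one_mul]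
      have : ∀ j : Fin n, ∫ z', (g k (z' j) - g k (z j)) ∂P = ∫ x, g k x ∂μ - g k (z j) :=
        fun j => by
          rw [integral_sub (hgi j) (integrable_const _), hge]; simp
      simp_rw [this]
      rw [Finset.sum_sub_distrib, mul_sub]
      simp
      field_simp
    · intro j _
      exact ((hgi j).sub (integrable_const _)).const_mul _
  rw [e]
  refine integral_mono ?_ ?_ fun z' => ?_
  · refine aux_intb _ ?_ M fun z' => aux_win g M hM hg0 hgM (fun _ => true) (z, z') k
    have := hg k
    fun_prop
  · exact aux_intb _ ((aux_wmeas g hg _).comp (by fun_prop)) M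
      fun z' => aux_supabs _ M (aux_win g M hM hg0 hgM _ (z, z'))
  · exact le_ciSup (aux_bdd _ M (aux_win g M hM hg0 hgM (fun _ => true) (z, z'))) k

omit hM hg0 hgM [Nonempty ι] in
include hg in
lemma aux_stepB (σ : Fin n → Bool) :
    ∫ p, symW g (fun _ => true) p
          ∂((Measure.pi fun _ : Fin n => μ).prod (Measure.pi fun _ : Fin n => μ))
    = ∫ p, symW g σ p
          ∂((Measure.pi fun _ : Fin n => μ).prod (Measure.pi fun _ : Fin n => μ)) := by
  have mpe := measurePreserving_arrowProdEquivProdArrow Z Z (Fin n) (fun _ => μ) (fun _ => μ)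
  rw [← mpe.integral_comp', ← mpe.integral_comp']
  have mpt : MeasurePreserving (fun (p : Fin n → Z × Z) j => if σ j then p j else (p j).swap)
      (Measure.pi fun _ : Fin n => μ.prod μ) (Measure.pi fun _ : Fin n => μ.prod μ) := by
    refine measurePreserving_pi _ _ (f := fun j (q : Z × Z) => if σ j then q else q.swap) fun j => ?_
    cases σ j
    · simpa using Measure.measurePreserving_swap (μ := μ) (ν := μ)
    · simp only [if_true]
      exact MeasurePreserving.id (μ.prod μ)
  have hm := (aux_wmeas g hg (fun _ : Fin n => true)).comp
    (MeasurableEquiv.arrowProdEquivProdArrow Z Z (Fin n)).measurable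
  have := integral_map (μ := Measure.pi fun _ : Fin n => μ.prod μ) mpt.measurable.aemeasurable
    (f := fun p => symW g (fun _ => true) (MeasurableEquiv.arrowProdEquivProdArrow Z Z (Fin n) p))
    hm.aestronglyMeasurable
  rw [mpt.map_eq] at this
  rw [this]
  congr 1
  ext p
  unfold symW
  congr 1
  ext k
  congr 1
  refine Finset.sum_congr rfl fun j _ => ?_
  show radSign true * (g k (if σ j then p j else (p j).swap).2 -
    g k (if σ j then p j else (p j).swap).1) = radSign (σ j) * (g k (p j).2 - g k (p j).1)
  cases σ j <;> simp [radSign]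

include hg in
lemma aux_stepC (σ : Fin n → Bool) :
    ∫ p, symW g σ p
          ∂((Measure.pi fun _ : Fin n => μ).prod (Measure.pi fun _ : Fin n => μ))
    ≤ ∫ z, rSup g σ z ∂(Measure.pi fun _ : Fin n => μ)
      + ∫ z, rSup g (fun j => !(σ j)) z ∂(Measure.pi fun _ : Fin n => μ) := by
  set P := Measure.pi fun _ : Fin n => μ with hP
  have i1 : Integrable (fun p : (Fin n → Z) × (Fin n → Z) => rSup g σ p.2) (P.prod P) :=
    aux_intb _ ((aux_rmeas g hg σ).comp measurable_snd) M fun p => aux_rabs g M hM hg0 hgM _ _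
  have i2 : Integrable (fun p : (Fin n → Z) × (Fin n → Z) => rSup g (fun j => !(σ j)) p.1)
      (P.prod P) :=
    aux_intb _ ((aux_rmeas g hg _).comp measurable_fst) M fun p => aux_rabs g M hM hg0 hgM _ _
  have e1 : ∫ p, rSup g σ p.2 ∂(P.prod P) = ∫ z, rSup g σ z ∂P := by
    have mp := measurePreserving_snd (μ := P) (ν := P)
    have := integral_map (μ := P.prod P) mp.measurable.aemeasurable (f := rSup g σ)
      (aux_rmeas g hg σ).aestronglyMeasurable
    rw [mp.map_eq] at this
    exact this.symm
  have e2 : ∫ p, rSup g (fun j => !(σ j)) p.1 ∂(P.prod P)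
      = ∫ z, rSup g (fun j => !(σ j)) z ∂P := by
    have mp := measurePreserving_fst (μ := P) (ν := P)
    have := integral_map (μ := P.prod P) mp.measurable.aemeasurable
      (f := rSup g (fun j => !(σ j))) (aux_rmeas g hg _).aestronglyMeasurable
    rw [mp.map_eq] at this
    exact this.symm
  rw [← e1, ← e2, ← integral_add i1 i2]
  refine integral_mono (aux_wint g hg M hM hg0 hgM σ _) (i1.add i2) fun p => ?_
  refine ciSup_le fun k => ?_
  have a1 := le_ciSup (aux_bdd _ M (aux_rin g M hM hg0 hgM σ p.2)) k
  have a2 := le_ciSup (aux_bdd _ M (aux_rin g M hM hg0 hgM (fun j => !(σ j)) p.1)) k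
  refine le_trans (le_of_eq ?_) (add_le_add a1 a2)
  rw [← mul_add, ← Finset.sum_add_distrib]
  congr 1
  refine Finset.sum_congr rfl fun j _ => ?_
  rw [aux_radSign_not]; ring

include hg in
lemma aux_symm (hn : 1 ≤ n) :
    ∫ z, dev g μ z ∂(Measure.pi fun _ : Fin n => μ)
      ≤ 2 * ∫ z, rad g z ∂(Measure.pi fun _ : Fin n => μ) := by
  set P := Measure.pi fun _ : Fin n => μ with hP
  set J : (Fin n → Bool) → ℝ := fun σ => ∫ z, rSup g σ z ∂P with hJ
  have h1 : ∀ σ : Fin n → Bool, ∫ z, dev g μ z ∂P ≤ J σ + J (fun j => !(σ j)) := fun σ =>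
    (aux_stepA g hg M hM hg0 hgM μ hn).trans
      ((aux_stepB g hg μ σ).le.trans (aux_stepC g hg M hM hg0 hgM μ σ))
  have hJb : ∀ σ, |J σ| ≤ M := fun σ => aux_intabs _ M fun z => aux_rabs g M hM hg0 hgM _ _
  have hJi : Integrable J (radB n) := aux_intb _ (measurable_of_countable _) M hJb
  have hJi2 : Integrable (fun σ : Fin n → Bool => J (fun j => !(σ j))) (radB n) :=
    aux_intb _ (measurable_of_countable _) M fun σ => hJb _
  have h2 : ∫ z, dev g μ z ∂P ≤ ∫ σ, (J σ + J (fun j => !(σ j))) ∂(radB n) := by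
    have := integral_mono (μ := radB n) (integrable_const (∫ z, dev g μ z ∂P)) (hJi.add hJi2) h1
    simpa using this
  rw [integral_add hJi hJi2, aux_not_int n J] at h2
  have h3 : ∫ z, rad g z ∂P = ∫ σ, J σ ∂(radB n) := by
    unfold rad
    rw [hJ]
    refine (integral_integral_swap (f := fun (σ : Fin n → Bool) (z : Fin n → Z) => rSup g σ z)
      ?_).symm
    exact aux_intb _ (aux_rmeas2 g hg) M fun p => aux_rabs g M hM hg0 hgM _ _
  rw [h3]; linarith

def gG (g : ι → Z → ℝ) (μ : Measure Z) (k0 : ι) {n : ℕ} (z : Fin n → Z) : ℝ :=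
  dev g μ z - 2 * rad g z + ((1 / (n : ℝ)) * ∑ j, g k0 (z j) - ∫ x, g k0 x ∂μ)

omit hM hg0 hgM [Nonempty ι] [IsProbabilityMeasure μ] in
include hg in
lemma aux_Gmeas (k0 : ι) : Measurable (gG g μ k0 (n := n)) := by
  unfold gG
  have h1 := aux_devmeas g hg μ (n := n)
  have h2 := aux_radmeas g hg (n := n)
  have h3 := hg k0
  fun_prop

omit [Countable ι] in
lemma aux_Gabs (k0 : ι) (z : Fin n → Z) : |gG g μ k0 z| ≤ 4 * M := by
  have h1 := abs_le.1 (aux_devabs g M hM hg0 hgM μ z)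
  have h2 := abs_le.1 (aux_radabs g M hM hg0 hgM z)
  have h3 := abs_le.1 (aux_devin g M hM hg0 hgM μ z k0)
  unfold gG
  exact abs_le.2 ⟨by linarith, by linarith⟩

omit [Countable ι] in
lemma aux_Gdiff (k0 : ι) (z : Fin n → Z) (i : Fin n) (y : Z) :
    |gG g μ k0 z - gG g μ k0 (Function.update z i y)| ≤ 4 * M / n := by
  have h1 := abs_le.1 (aux_devdiff g M hM hg0 hgM μ z i y)
  have h2 := abs_le.1 (aux_raddiff g M hM hg0 hgM z i y)
  have h3 := abs_le.1 (aux_upd (fun _ => g k0) M (fun _ => aux_gdiff g M hg0 hgM k0) z i y)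
  have : 4 * M / n = 4 * (M / n) := by ring
  rw [this]
  unfold gG
  exact abs_le.2 ⟨by linarith, by linarith⟩

include hg in
lemma aux_Gint (k0 : ι) (hn : 1 ≤ n) :
    ∫ z, gG g μ k0 z ∂(Measure.pi fun _ : Fin n => μ) ≤ 0 := by
  set P := Measure.pi fun _ : Fin n => μ with hP
  have hs := aux_symm g hg M hM hg0 hgM μ hn
  have hn' : (n : ℝ) ≠ 0 := by positivity
  have hgi : ∀ j : Fin n, Integrable (fun z' : Fin n → Z => g k0 (z' j)) P := fun j =>
    aux_intb _ ((hg k0).comp (measurable_pi_apply j)) M fun z' => aux_gabs g M hg0 hgM k0 _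
  have hge : ∀ j : Fin n, ∫ z', g k0 (z' j) ∂P = ∫ x, g k0 x ∂μ := fun j => by
    have mp := measurePreserving_eval (fun _ : Fin n => μ) j
    have := integral_map (μ := P) mp.measurable.aemeasurable (f := g k0)
      (hg k0).aestronglyMeasurable
    rw [mp.map_eq] at this
    exact this.symm
  have i1 : Integrable (dev g μ (n := n)) P :=
    aux_intb _ (aux_devmeas g hg μ) M (aux_devabs g M hM hg0 hgM μ)
  have i2 : Integrable (fun z : Fin n → Z => 2 * rad g z) P :=
    (aux_intb _ (aux_radmeas g hg) M (aux_radabs g M hM hg0 hgM)).const_mul 2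
  have i3 : Integrable (fun z : Fin n → Z => (1 / (n : ℝ)) * ∑ j, g k0 (z j)) P :=
    (integrable_finsetSum _ fun j _ => hgi j).const_mul _
  have e : ∫ z, ((1 / (n : ℝ)) * ∑ j, g k0 (z j) - ∫ x, g k0 x ∂μ) ∂P = 0 := by
    rw [integral_sub i3 (integrable_const _), integral_const_mul,
      integral_finsetSum _ fun j _ => hgi j]
    simp_rw [hge]
    simp
    field_simp
    simp
  unfold gG
  have i12 : Integrable (fun z : Fin n → Z => dev g μ z - 2 * rad g z) P := i1.sub i2
  have i34 : Integrable (fun z : Fin n → Z => (1 / (n : ℝ)) * ∑ j, g k0 (z j)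
      - ∫ x, g k0 x ∂μ) P := i3.sub (integrable_const _)
  rw [integral_add i12 i34, e, integral_sub i1 i2, integral_const_mul]
  linarith

include hg in
lemma aux_Gmgf (k0 : ι) (hn : 1 ≤ n) (s : ℝ) (hs : 0 ≤ s) :
    ∫ z, Real.exp (s * gG g μ k0 z) ∂(Measure.pi fun _ : Fin n => μ)
      ≤ Real.exp (2 * s ^ 2 * M ^ 2 / n) := by
  set P := Measure.pi fun _ : Fin n => μ with hP
  have h0 := aux_Gint g hg M hM hg0 hgM μ k0 hn
  rw [← hP] at h0
  have h1 := aux_mcd μ (4 * M / n) (4 * M) s n (gG g μ k0) (aux_Gmeas g hg μ k0)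
    (aux_Gabs g M hM hg0 hgM μ k0) (aux_Gdiff g M hM hg0 hgM μ k0)
  rw [← hP] at h1
  set E := ∫ z, gG g μ k0 z ∂P with hE
  have hGm := aux_Gmeas g hg μ k0 (n := n)
  have hn' : (n : ℝ) ≠ 0 := by positivity
  calc _ ≤ ∫ z, Real.exp (s * (gG g μ k0 z - E)) ∂P := by
        refine integral_mono ?_ ?_ fun z => Real.exp_le_exp.2 ?_
        · refine aux_expint P (f := fun z => s * gG g μ k0 z) (by fun_prop) (s * (4 * M)) fun z => ?_
          rw [abs_mul, abs_of_nonneg hs]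
          exact mul_le_mul_of_nonneg_left (aux_Gabs g M hM hg0 hgM μ k0 z) hs
        · refine aux_expint P (f := fun z => s * (gG g μ k0 z - E)) (by fun_prop)
            (s * (4 * M + |E|)) fun z => ?_
          rw [abs_mul, abs_of_nonneg hs]
          refine mul_le_mul_of_nonneg_left ((abs_sub _ _).trans ?_) hs
          linarith [aux_Gabs g M hM hg0 hgM μ k0 z]
        · exact mul_le_mul_of_nonneg_left (by linarith) hs
    _ ≤ _ := h1
    _ = _ := by congr 1; field_simp; ring

end sym

/-- Theorem 1: with probability at least `1 - δ`, the minimizer of the α-weighted empirical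
risk has target risk bounded by the optimal target risk plus complexity, discrepancy and
concentration terms. -/
theorem main_bound {ι : Type*} [Countable ι] [Nonempty ι]
    (L : Y → Y → ℝ) (hLmeas : Measurable (Function.uncurry L))
    (M : ℝ) (hM : 0 < M) (hL0 : ∀ y y', 0 ≤ L y y') (hLM : ∀ y y', L y y' ≤ M)
    (h : ι → X → Y) (hmeas : ∀ k, Measurable (h k))
    {N : ℕ} (D : Fin N → Measure (X × Y)) [∀ i, IsProbabilityMeasure (D i)]
    (DT : Measure (X × Y)) [IsProbabilityMeasure DT]
    (m : Fin N → ℕ) (hm : ∀ i, 1 ≤ m i)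
    (α : Fin N → ℝ) (hα : ∀ i, 0 ≤ α i) (hαs : ∑ i, α i = 1)
    (δ : ℝ) (hδ : 0 < δ)
    (hhat : ((i : Fin N) → Fin (m i) → X × Y) → ι)
    (hhat_min : ∀ S k, empRisk L m α S (h (hhat S)) ≤ empRisk L m α S (h k))
    (kstar : ι) (hstar_min : ∀ k, expRisk L DT (h kstar) ≤ expRisk L DT (h k)) :
    ENNReal.ofReal (1 - δ) ≤
      sampleMeasure m D
        {S | expRisk L DT (h (hhat S)) ≤
          expRisk L DT (h kstar)
          + 4 * ∑ i, α i * radComplexity L h m S i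
          + 2 * ∑ i, α i * discrepancy L h (D i) DT
          + 6 * Real.sqrt (Real.log (4 / δ) * M ^ 2 / 2)
              * Real.sqrt (∑ i, α i ^ 2 / (m i : ℝ))} := by
  rcases le_or_gt 1 δ with hδ1 | hδ1
  · rw [ENNReal.ofReal_of_nonpos (by linarith)]; exact zero_le
  set g : ι → X × Y → ℝ := fun k z => L (h k z.1) z.2 with hgdef
  have hg : ∀ k, Measurable (g k) := fun k =>
    hLmeas.comp (((hmeas k).comp measurable_fst).prodMk measurable_snd)
  have hg0 : ∀ k z, 0 ≤ g k z := fun k z => hL0 _ _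
  have hgM : ∀ k z, g k z ≤ M := fun k z => hLM _ _
  have hprob : IsProbabilityMeasure (sampleMeasure m D) := by
    unfold sampleMeasure; infer_instance
  have hrad : ∀ S i, radComplexity L h m S i = rad g (S i) := by
    intro S i
    unfold radComplexity rad
    have mp := measurePreserving_eval (fun i : Fin N => radB (m i)) i
    have := integral_map (μ := Measure.pi fun i : Fin N => radB (m i)) mp.measurable.aemeasurable (f := fun σ => rSup g σ (S i))
      (measurable_of_countable _).aestronglyMeasurable
    rw [mp.map_eq] at this
    exact this.symm
  set A : ℝ := ∑ i, α i ^ 2 / (m i : ℝ) with hA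
  have hmpos : ∀ i, (0 : ℝ) < m i := fun i => by exact_mod_cast hm i
  have hApos : 0 < A := by
    have hnn : ∀ i ∈ Finset.univ, 0 ≤ α i ^ 2 / (m i : ℝ) := fun i _ =>
      div_nonneg (sq_nonneg _) (hmpos i).le
    refine lt_of_le_of_ne (Finset.sum_nonneg hnn) fun h0 => ?_
    have hz := (Finset.sum_eq_zero_iff_of_nonneg hnn).1 h0.symm
    have : ∀ i, α i = 0 := fun i => by
      have := hz i (Finset.mem_univ i)
      rw [div_eq_zero_iff] at this
      rcases this with h | h
      · exact pow_eq_zero_iff (two_ne_zero) |>.1 h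
      · exact absurd h (hmpos i).ne'
    simp [this] at hαs
  set l : ℝ := Real.log (4 / δ) with hl
  have hl0 : 0 ≤ l := Real.log_nonneg (by rw [le_div_iff₀ hδ]; linarith)
  set t : ℝ := 6 * Real.sqrt (l * M ^ 2 / 2) * Real.sqrt A with ht
  have ht0 : 0 ≤ t := by positivity
  have ht2 : t ^ 2 = 18 * l * M ^ 2 * A := by
    rw [ht, mul_pow, mul_pow, Real.sq_sqrt (by positivity), Real.sq_sqrt hApos.le]; ring
  set G : ((i : Fin N) → Fin (m i) → X × Y) → ℝ :=
    fun S => ∑ i, α i * gG g (D i) kstar (S i) with hG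
  have hGm : Measurable G := by
    refine Finset.measurable_sum _ fun i _ => ?_
    exact ((aux_Gmeas g hg (D i) kstar).comp (measurable_pi_apply i)).const_mul _
  have hGabs : ∀ S, |G S| ≤ 4 * M := by
    intro S
    refine (Finset.abs_sum_le_sum_abs _ _).trans ?_
    calc _ ≤ ∑ i, α i * (4 * M) := Finset.sum_le_sum fun i _ => by
            rw [abs_mul, abs_of_nonneg (hα i)]
            exact mul_le_mul_of_nonneg_left (aux_Gabs g M hM hg0 hgM (D i) kstar (S i)) (hα i)
      _ = 4 * M := by rw [← Finset.sum_mul, hαs, one_mul]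
  -- moment generating function
  have hmgf : ∀ s, 0 ≤ s → ProbabilityTheory.mgf G (sampleMeasure m D) s
      ≤ Real.exp (2 * s ^ 2 * M ^ 2 * A) := by
    intro s hs
    unfold ProbabilityTheory.mgf sampleMeasure
    have : ∀ S, Real.exp (s * G S) = ∏ i, Real.exp ((s * α i) * gG g (D i) kstar (S i)) := by
      intro S
      rw [hG, ← Real.exp_sum, Finset.mul_sum]
      simp only [mul_assoc]
    simp_rw [this]
    rw [integral_fintype_prod_eq_prod
      (fun i (z : Fin (m i) → X × Y) => Real.exp ((s * α i) * gG g (D i) kstar z))]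
    calc _ ≤ ∏ i, Real.exp (2 * (s * α i) ^ 2 * M ^ 2 / (m i)) :=
          Finset.prod_le_prod (fun i _ => integral_nonneg fun z => (Real.exp_pos _).le)
            fun i _ => aux_Gmgf g hg M hM hg0 hgM (D i) kstar (hm i) _ (mul_nonneg hs (hα i))
      _ = _ := by
        rw [← Real.exp_sum, hA, Finset.mul_sum]
        congr 1
        refine Finset.sum_congr rfl fun i _ => ?_
        ring
  have htail : (sampleMeasure m D).real {S | t ≤ G S} ≤ δ := by
    set s := t / (4 * M ^ 2 * A) with hs
    have hs0 : 0 ≤ s := by positivity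
    have hi : Integrable (fun S => Real.exp (s * G S)) (sampleMeasure m D) :=
      aux_expint _ (f := fun S => s * G S) (by fun_prop) (s * (4 * M)) fun S => by
        rw [abs_mul, abs_of_nonneg hs0]; exact mul_le_mul_of_nonneg_left (hGabs S) hs0
    refine (ProbabilityTheory.measure_ge_le_exp_mul_mgf t hs0 hi).trans ?_
    refine (mul_le_mul_of_nonneg_left (hmgf s hs0) (Real.exp_pos _).le).trans ?_
    rw [← Real.exp_add]
    have e : -s * t + 2 * s ^ 2 * M ^ 2 * A = - (9 / 4 * l) := by
      have : -s * t + 2 * s ^ 2 * M ^ 2 * A = - (t ^ 2 / (8 * M ^ 2 * A)) := by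
        rw [hs]; field_simp; ring
      rw [this, ht2]; field_simp; ring
    rw [e]
    calc Real.exp (-(9 / 4 * l)) ≤ Real.exp (-l) := Real.exp_le_exp.2 (by linarith)
      _ = δ / 4 := by rw [Real.exp_neg, hl, Real.exp_log (by positivity), inv_div]
      _ ≤ δ := by linarith
  have hgood : ENNReal.ofReal (1 - δ) ≤ sampleMeasure m D {S | t ≤ G S}ᶜ := by
    have hms : MeasurableSet {S | t ≤ G S} := measurableSet_le measurable_const hGm
    rw [← ofReal_measureReal, probReal_compl_eq_one_sub hms]
    exact ENNReal.ofReal_le_ofReal (by linarith)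
  refine hgood.trans (measure_mono fun S hS => ?_)
  have hS' : G S < t := not_le.1 hS
  show expRisk L DT (h (hhat S)) ≤ _
  simp_rw [hrad]
  set k := hhat S with hk
  have hemp : ∀ k, empRisk L m α S (h k)
      = ∑ i, α i * ((1 / (m i : ℝ)) * ∑ j, g k (S i j)) := fun k => by
    unfold empRisk
    refine Finset.sum_congr rfl fun i _ => ?_
    rw [← mul_assoc, mul_one_div]
  have hd : ∀ i k, |expRisk L (D i) (h k) - expRisk L DT (h k)| ≤ discrepancy L h (D i) DT := by
    intro i k
    refine le_ciSup (f := fun k => |expRisk L (D i) (h k) - expRisk L DT (h k)|)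
      ⟨M + M, ?_⟩ k
    rintro _ ⟨k, rfl⟩
    refine (abs_sub _ _).trans (add_le_add ?_ ?_)
    · exact aux_intabs (D i) M (aux_gabs g M hg0 hgM k)
    · exact aux_intabs DT M (aux_gabs g M hg0 hgM k)
  have hsum : ∑ i, α i * ((1 / (m i : ℝ)) * ∑ j, g k (S i j))
      ≤ ∑ i, α i * ((1 / (m i : ℝ)) * ∑ j, g kstar (S i j)) := by
    rw [← hemp, ← hemp]; exact hhat_min S kstar
  have hterm : ∑ i, α i * (expRisk L DT (h k) - expRisk L DT (h kstar)) ≤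
      ∑ i, α i * (gG g (D i) kstar (S i) + 4 * rad g (S i) + 2 * discrepancy L h (D i) DT
        + (1 / (m i : ℝ)) * ∑ j, g k (S i j) - (1 / (m i : ℝ)) * ∑ j, g kstar (S i j)) := by
    refine Finset.sum_le_sum fun i _ => mul_le_mul_of_nonneg_left ?_ (hα i)
    have h1 := (abs_le.1 (hd i k)).1
    have h2 := (abs_le.1 (hd i kstar)).2
    have h3 : expRisk L (D i) (h k) - (1 / (m i : ℝ)) * ∑ j, g k (S i j) ≤ dev g (D i) (S i) :=
      le_ciSup (aux_bdd _ M (aux_devin g M hM hg0 hgM (D i) (S i))) k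
    have h4 := aux_rad_nonneg g M hM hg0 hgM (S i)
    have h5 : ∫ x, g kstar x ∂(D i) = expRisk L (D i) (h kstar) := rfl
    unfold gG
    rw [h5]
    linarith
  rw [← Finset.sum_mul, hαs, one_mul] at hterm
  have hsplit : ∑ i, α i * (gG g (D i) kstar (S i) + 4 * rad g (S i)
        + 2 * discrepancy L h (D i) DT
        + (1 / (m i : ℝ)) * ∑ j, g k (S i j) - (1 / (m i : ℝ)) * ∑ j, g kstar (S i j))
      = G S + 4 * ∑ i, α i * rad g (S i) + 2 * ∑ i, α i * discrepancy L h (D i) DT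
        + ∑ i, α i * ((1 / (m i : ℝ)) * ∑ j, g k (S i j))
        - ∑ i, α i * ((1 / (m i : ℝ)) * ∑ j, g kstar (S i j)) := by
    rw [hG]
    simp only [Finset.mul_sum (Finset.univ : Finset (Fin N)), ← Finset.sum_add_distrib,
      ← Finset.sum_sub_distrib]
    refine Finset.sum_congr rfl fun i _ => ?_
    ring
  rw [hsplit] at hterm
  linarith

end
end

section
/- Flipped-labels identity for the empirical discrepancy under the 0/1 loss: with binary labels Y = {−1, +1}, a symmetric hypothesis class H (h ∈ H implies −h ∈ H) of real-valued predictors h : X → ℝ that never output 0, and 0/1 loss L(h(x), y) = 1{h(x) · y < 0}, the empirical discrepancy between a source sample S_i and the target sample S_T satisfies d_H(S_i, S_T) = 1 − inf_{h∈H} [ (1/m_i) Σ_{j=1}^{m_i} 1{h(x_{i,j}) · ȳ_{i,j} < 0} + (1/m_T) Σ_{j=1}^{m_T} 1{h(x_{T,j}) · y_{T,j} < 0} ], where ȳ_{i,j} = −y_{i,j} denotes the flipped label of the j-th point of the i-th source. -/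
noncomputable section

theorem risk_flip_aux (m : ℕ) (hm : 1 ≤ m) (f g : Fin m → ℝ) (hf : ∀ j, f j ≠ 0)
    (hg : ∀ j, g j = - f j) :
    (1 / (m : ℝ)) * ∑ j, (if g j < 0 then (1 : ℝ) else 0)
      = 1 - (1 / (m : ℝ)) * ∑ j, (if f j < 0 then (1 : ℝ) else 0) := by
  have hm0 : (m : ℝ) ≠ 0 := by positivity
  have h1 : ∀ j, (if g j < 0 then (1 : ℝ) else 0) = 1 - (if f j < 0 then (1 : ℝ) else 0) := by
    intro j
    rw [hg j]
    rcases lt_or_gt_of_ne (hf j) with h | h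
    · rw [if_neg (by linarith), if_pos h]; norm_num
    · rw [if_pos (by linarith), if_neg (by linarith)]; norm_num
  simp only [h1, Finset.sum_sub_distrib]
  simp
  field_simp

theorem risk_nonneg_aux (m : ℕ) (f : Fin m → ℝ) :
    0 ≤ (1 / (m : ℝ)) * ∑ j, (if f j < 0 then (1 : ℝ) else 0) := by
  refine mul_nonneg (by positivity) (Finset.sum_nonneg fun j _ => ?_)
  split_ifs <;> norm_num

theorem sup_inf_aux {ι : Type*} [Nonempty ι] (A A' B : ι → ℝ) (hA : ∀ k, 0 ≤ A k)
    (hB : ∀ k, 0 ≤ B k) (hA0 : ∀ k, 0 ≤ A' k) (hA' : ∀ k, A' k = 1 - A k)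
    (hs : ∀ k, ∃ k', A k' = 1 - A k ∧ B k' = 1 - B k) :
    (⨆ k, |A k - B k|) = 1 - ⨅ k, (A' k + B k) := by
  have hbd : BddBelow (Set.range fun k => A' k + B k) :=
    ⟨0, by rintro _ ⟨k, rfl⟩; exact add_nonneg (hA0 k) (hB k)⟩
  have hle : ∀ k, |A k - B k| ≤ 1 - ⨅ k, (A' k + B k) := by
    intro k
    obtain ⟨k', h1, h2⟩ := hs k
    have e1 := ciInf_le hbd k
    have e2 := ciInf_le hbd k'
    simp only [hA'] at e1 e2 ⊢
    rw [abs_le]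
    constructor <;> linarith
  apply le_antisymm
  · exact ciSup_le hle
  · have : 1 - (⨆ k, |A k - B k|) ≤ ⨅ k, (A' k + B k) := by
      refine le_ciInf fun k => ?_
      have e := le_ciSup (f := fun k => |A k - B k|)
        ⟨_, by rintro _ ⟨k, rfl⟩; exact hle k⟩ k
      have := le_abs_self (A k - B k)
      have := hA' k
      linarith
    linarith

/-- Flipped-labels identity for the empirical discrepancy under the 0/1 loss:
for binary labels in `{-1, +1}`, a symmetric class of nowhere-zero real-valued
predictors, the empirical discrepancy between a source sample and the target sample
equals one minus the infimum of the empirical risk on the merged sample with the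
source labels flipped. -/
theorem flipped_labels_identity {X : Type*} {ι : Type*} [Nonempty ι]
    (h : ι → X → ℝ) (hne : ∀ k x, h k x ≠ 0)
    (hsym : ∀ k : ι, ∃ k' : ι, ∀ x, h k' x = -(h k x))
    (mi mT : ℕ) (hmi : 1 ≤ mi) (hmT : 1 ≤ mT)
    (xi : Fin mi → X) (yi : Fin mi → ℝ) (hyi : ∀ j, yi j = 1 ∨ yi j = -1)
    (xT : Fin mT → X) (yT : Fin mT → ℝ) (hyT : ∀ j, yT j = 1 ∨ yT j = -1) :
    (⨆ k : ι,
        |(1 / (mi : ℝ)) * ∑ j, (if h k (xi j) * yi j < 0 then (1 : ℝ) else 0)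
          - (1 / (mT : ℝ)) * ∑ j, (if h k (xT j) * yT j < 0 then (1 : ℝ) else 0)|)
      = 1 - ⨅ k : ι,
          ((1 / (mi : ℝ)) * ∑ j, (if h k (xi j) * (-(yi j)) < 0 then (1 : ℝ) else 0)
            + (1 / (mT : ℝ)) * ∑ j, (if h k (xT j) * yT j < 0 then (1 : ℝ) else 0)) := by
  have hi : ∀ k j, h k (xi j) * yi j ≠ 0 := fun k j =>
    mul_ne_zero (hne _ _) (by rcases hyi j with e | e <;> rw [e] <;> norm_num)
  have hT : ∀ k j, h k (xT j) * yT j ≠ 0 := fun k j =>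
    mul_ne_zero (hne _ _) (by rcases hyT j with e | e <;> rw [e] <;> norm_num)
  refine sup_inf_aux _ _ _ (fun k => risk_nonneg_aux mi fun j => h k (xi j) * yi j)
    (fun k => risk_nonneg_aux mT fun j => h k (xT j) * yT j)
    (fun k => risk_nonneg_aux mi fun j => h k (xi j) * (-(yi j)))
    (fun k => risk_flip_aux mi hmi (fun j => h k (xi j) * yi j)
      (fun j => h k (xi j) * (-(yi j))) (hi k) (fun j => by ring)) (fun k => ?_)
  obtain ⟨k', hk⟩ := hsym k
  exact ⟨k', risk_flip_aux mi hmi (fun j => h k (xi j) * yi j)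
      (fun j => h k' (xi j) * yi j) (hi k) (fun j => by simp only [hk]; ring),
    risk_flip_aux mT hmT (fun j => h k (xT j) * yT j)
      (fun j => h k' (xT j) * yT j) (hT k) (fun j => by simp only [hk]; ring)⟩

end
end
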